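/- arXiv:2501.10616 — 2 statements merged into one kernel-verified Lean document; each statement's English description precedes it below -/
import Mathlib

section
/- For all integers n ≥ 1 and all even integers ℓ with 0 ≤ ℓ ≤ n, the partial evaluation for the sequence of positive integers satisfies ℕ^φ(n,ℓ) ≤ 3ℓ + 6. -/
/-- `scorePartial a n j` is the partial evaluation `A^φ(n, n - j)` of the
adversarial totient iteration for the sequence `a` (indexed from 1):
`scorePartial a n 0 = 0` corresponds to `A^φ(n,n) = 0`, and
`scorePartial a n (j+1) = φ(a (n-j) + scorePartial a n j)` corresponds to the
recurrence `A^φ(n,k-1) = φ(a_k + A^φ(n,k))` with `k = n - j`.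
Hence `A^φ(n,k) = scorePartial a n (n - k)`, and the scoreboard function is
`A^φ(n) = A^φ(n,0) = scorePartial a n n`. -/
def scorePartial (a : ℕ → ℕ) (n : ℕ) : ℕ → ℕ
  | 0 => 0
  | j + 1 => Nat.totient (a (n - j) + scorePartial a n j)

theorem totient_two_mul_le (a : ℕ) : Nat.totient (2 * a) ≤ a := by
  induction a using Nat.strong_induction_on with
  | _ a ih =>
    rcases Nat.even_or_odd a with h | h
    · obtain ⟨b, rfl⟩ := even_iff_exists_two_mul.mp h
      rcases Nat.eq_zero_or_pos b with rfl | hb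
      · simp
      · rw [Nat.totient_two_mul_of_even h]
        have := ih b (by omega)
        omega
    · rw [Nat.totient_two_mul_of_odd h]
      exact Nat.totient_le a

theorem totient_le_half_of_even {x : ℕ} (hx : Even x) : 2 * Nat.totient x ≤ x := by
  obtain ⟨b, rfl⟩ := even_iff_exists_two_mul.mp hx
  have := totient_two_mul_le b
  omega

/-- At even positions the partial evaluations for the positive integers satisfy the linear bound,
and they are even except possibly at position `0`. -/
theorem scorePartial_id_bound (n : ℕ) : ∀ j, j ≤ n → Even (n - j) →
    scorePartial (fun i => i) n j ≤ 3 * (n - j) + 6 ∧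
      (Even (scorePartial (fun i => i) n j) ∨ n = j)
  | 0, _, _ => by simp [scorePartial]
  | 1, h1, _ => by
    simp only [scorePartial, Nat.sub_zero, Nat.add_zero]
    have hle := Nat.totient_le n
    refine ⟨by omega, ?_⟩
    by_cases hn : n = 1
    · exact Or.inr hn
    · left
      rcases Nat.lt_or_ge 2 n with h | h
      · exact Nat.totient_even h
      · obtain rfl : n = 2 := by omega
        simp_all
  | j + 2, hj, he => by
    have he' : Even (n - j) := by
      have : n - j = n - (j + 2) + 2 := by omega
      rw [this]
      exact he.add even_two
    obtain ⟨hb, hp⟩ := scorePartial_id_bound n j (by omega) he'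
    have hs : Even (scorePartial (fun i => i) n j) := hp.resolve_right (by omega)
    simp only [scorePartial]
    generalize scorePartial (fun i => i) n j = s at hb hs
    have hhalf := totient_le_half_of_even (he'.add hs)
    have hpos : 0 < Nat.totient (n - j + s) := Nat.totient_pos.mpr (by omega)
    generalize Nat.totient (n - j + s) = t at hhalf hpos
    rcases Nat.lt_or_ge 2 (n - (j + 1) + t) with h | h
    · have heven := Nat.totient_even h
      have hlt := Nat.totient_lt (n - (j + 1) + t) (by omega)
      refine ⟨?_, Or.inl heven⟩
      obtain ⟨u, hu⟩ := heven
      obtain ⟨v, hv⟩ := he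
      omega
    · have hle := Nat.totient_le (n - (j + 1) + t)
      exact ⟨by omega, Or.inr (by omega)⟩

theorem stmt_1 (n l : ℕ) (hn : 1 ≤ n) (hl : Even l) (hln : l ≤ n) :
    scorePartial (fun j => j) n (n - l) ≤ 3 * l + 6 := by
  have h := (scorePartial_id_bound n (n - l) (Nat.sub_le n l)
    (by rwa [Nat.sub_sub_self hln])).1
  rwa [Nat.sub_sub_self hln] at h
end

section
/- For all integers n ≥ 1, the value ℕ^φ(n) = φ(1+φ(2+φ(3+...+φ(n)...))) belongs to the set {1, 2, 4, 6}. -/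
theorem Nat.two_mul_totient_le_of_even {m : ℕ} (hm : Even m) : 2 * Nat.totient m ≤ m := by
  induction m using Nat.strong_induction_on with
  | _ m ih =>
    obtain ⟨r, rfl⟩ := hm
    rcases Nat.eq_zero_or_pos r with rfl | hpos
    · simp
    rw [← two_mul]
    rcases Nat.even_or_odd r with hr | hr
    · rw [Nat.totient_two_mul_of_even hr]
      have := ih r (by omega) hr
      omega
    · rw [Nat.totient_two_mul_of_odd hr]
      have := Nat.totient_le r
      omega

/-- Partial evaluations of the totient iteration on the positive integers grow linearly and
are even, as long as the index stays at least `3`. -/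
theorem scorePartial_id_even_and_le (n j : ℕ) (hj : j + 2 ≤ n) :
    Even (scorePartial (fun i => i) n j) ∧
      (Even (n - j) → scorePartial (fun i => i) n j ≤ 3 * (n - j) + 8) ∧
      (¬ Even (n - j) → scorePartial (fun i => i) n j ≤ 2 * (n - j) + 6) := by
  induction j with
  | zero => simp [scorePartial]
  | succ j ih =>
    obtain ⟨hx, he, ho⟩ := ih (by omega)
    simp only [scorePartial]
    generalize scorePartial (fun i => i) n j = x at *
    obtain ⟨k, hk⟩ : ∃ k, n - j = k + 1 := ⟨n - j - 1, by omega⟩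
    have hk' : n - (j + 1) = k := by omega
    rw [hk] at he ho ⊢
    rw [hk']
    refine ⟨Nat.totient_even (by omega), fun h => ?_, fun h => ?_⟩
    · have hlt := Nat.totient_lt (k + 1 + x) (by omega)
      have := ho (by simpa [Nat.even_add_one] using h)
      omega
    · have hk1 : Even (k + 1) := Nat.even_add_one.mpr h
      have := Nat.two_mul_totient_le_of_even (hk1.add hx)
      have := he hk1
      omega

theorem totient_iterate_from_six (x : ℕ) (hx : Even x) (hle : x ≤ 26) :
    Nat.totient (1 + Nat.totient (2 + Nat.totient (3 + Nat.totient (4 +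
      Nat.totient (5 + Nat.totient (6 + x)))))) ∈ ({1, 2, 4, 6} : Set ℕ) := by
  have key : ∀ x ≤ 26, x % 2 = 0 → Nat.totient (1 + Nat.totient (2 + Nat.totient (3 +
      Nat.totient (4 + Nat.totient (5 + Nat.totient (6 + x)))))) = 4 := by
    decide +kernel
  rw [key x hle (Nat.even_iff.mp hx)]
  simp

theorem stmt_2 (n : ℕ) (hn : 1 ≤ n) :
    scorePartial (fun j => j) n n ∈ ({1, 2, 4, 6} : Set ℕ) := by
  by_cases h : n < 6
  · have key : ∀ n < 6, 1 ≤ n → scorePartial (fun j => j) n n = 1 ∨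
        scorePartial (fun j => j) n n = 2 ∨ scorePartial (fun j => j) n n = 4 ∨
        scorePartial (fun j => j) n n = 6 := by
      decide +kernel
    simpa using key n h hn
  · obtain ⟨m, rfl⟩ : ∃ m, n = m + 6 := ⟨n - 6, by omega⟩
    obtain ⟨hx, he, -⟩ := scorePartial_id_even_and_le (m + 6) m (by omega)
    have hm : m + 6 - m = 6 := by omega
    rw [hm] at he
    have key := totient_iterate_from_six _ hx (he (by decide))
    have h1 : m + 6 - (m + 1) = 5 := by omega
    have h2 : m + 6 - (m + 2) = 4 := by omega
    have h3 : m + 6 - (m + 3) = 3 := by omega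
    have h4 : m + 6 - (m + 4) = 2 := by omega
    have h5 : m + 6 - (m + 5) = 1 := by omega
    have hs : scorePartial (fun j => j) (m + 6) (m + 6) =
        Nat.totient (1 + Nat.totient (2 + Nat.totient (3 + Nat.totient (4 +
          Nat.totient (5 + Nat.totient (6 + scorePartial (fun j => j) (m + 6) m)))))) := by
      rw [scorePartial, scorePartial, scorePartial, scorePartial, scorePartial, scorePartial,
        h1, h2, h3, h4, h5, hm]
    rw [hs]
    exact key
end
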